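/- For an integer k, there exists a 4×4 integer matrix P with Pᵀ P = k·I₄ if and only if k ≥ 0. (This is the algebraic content of: there is a degree k map f: (ℂP²)^{♯4} → (ℂP²)^{♯4} if and only if k is a nonnegative integer; the construction uses Lagrange's four-square theorem and, for k = a²+b²+c²+d², the matrix with rows (a,b,c,d), (b,-a,-d,c), (c,d,-a,-b), (d,-c,b,-a).) -/

import Mathlib

open Matrix

theorem degree_cp2_four_connected_sum (k : ℤ) :
    (∃ P : Matrix (Fin 4) (Fin 4) ℤ, Pᵀ * P = k • (1 : Matrix (Fin 4) (Fin 4) ℤ)) ↔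
      0 ≤ k := by
  constructor
  · rintro ⟨P, hP⟩
    have h : ∑ i, P i 0 * P i 0 = k := by
      simpa [Matrix.mul_apply] using congrFun (congrFun hP 0) 0
    rw [← h]
    exact Finset.sum_nonneg fun i _ => mul_self_nonneg (P i 0)
  · intro hk
    obtain ⟨n, rfl⟩ := Int.eq_ofNat_of_zero_le hk
    obtain ⟨a, b, c, d, rfl⟩ := Nat.sum_four_squares n
    refine ⟨!![(a : ℤ), b, c, d; b, -a, -d, c; c, d, -a, -b; d, -c, b, -a], ?_⟩
    ext i j
    fin_cases i <;> fin_cases j <;>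
      simp [Matrix.mul_apply, Fin.sum_univ_four] <;> ring
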